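/- arXiv:2312.03859 — 6 statements merged into one kernel-verified Lean document; each statement's English description precedes it below -/
import Mathlib

section
/- Let H be a non-bipartite graph with adjacency matrix A_H. For every integer k ≥ 1 and every set 𝒜 ⊆ V(H)^k, there exists a subset 𝒜' ⊆ 𝒜 of size at most mim(A_H^{⊗k}), and hence of size at most mimsup(A_H)^k, that A_H^{⊗k}-represents 𝒜 (rows and columns of A_H^{⊗k} are indexed by V(H)^k). -/
open Filter

section Defs

variable {I J K L : Type*}

/-- The matrix `M` has an `m × m` identity submatrix after permutation
(an induced matching of size `m`). -/
def HasMim (M : I → J → Prop) (m : ℕ) : Prop :=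
  ∃ (r : Fin m → I) (c : Fin m → J), Function.Injective r ∧ Function.Injective c ∧
    ∀ i j, M (r i) (c j) ↔ i = j

/-- `mim M` is the largest `m` such that `M` has an `m × m` identity submatrix
after permutation. -/
noncomputable def mim (M : I → J → Prop) : ℕ := sSup {m | HasMim M m}

/-- The matrix `M` has a half-induced matching of size `m`. -/
def HasHim (M : I → J → Prop) (m : ℕ) : Prop :=
  ∃ (r : Fin m → I) (c : Fin m → J), Function.Injective r ∧ Function.Injective c ∧
    (∀ i, M (r i) (c i)) ∧ ∀ i j : Fin m, i < j → ¬ M (r i) (c j)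

/-- `him M` is the largest `m` such that `M` has a half-induced matching of size `m`. -/
noncomputable def him (M : I → J → Prop) : ℕ := sSup {m | HasHim M m}

/-- Kronecker product of two 0/1 (`Prop`-valued) matrices. -/
def kron (M : I → J → Prop) (N : K → L → Prop) : I × K → J × L → Prop :=
  fun p q => M p.1 q.1 ∧ N p.2 q.2

/-- `k`-fold Kronecker power of a 0/1 (`Prop`-valued) matrix. -/
def kronPow (M : I → J → Prop) (k : ℕ) : (Fin k → I) → (Fin k → J) → Prop :=
  fun r c => ∀ t, M (r t) (c t)

/-- `mimsup M = limsup_{k → ∞} mim (M^{⊗ k}) ^ (1/k)`. -/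
noncomputable def mimsup (M : I → J → Prop) : ℝ :=
  Filter.atTop.limsup fun k : ℕ => (mim (kronPow M k) : ℝ) ^ (1 / (k : ℝ))

/-- `𝒜'` is a subset of `𝒜` that `M`-represents `𝒜`. -/
def Represents (M : I → J → Prop) (𝒜 𝒜' : Set I) : Prop :=
  𝒜' ⊆ 𝒜 ∧ ∀ j, (∃ i ∈ 𝒜, M i j) → ∃ i' ∈ 𝒜', M i' j

end Defs

section InducedMatchings

variable {I J : Type*}

theorem hasMim_card_of_forall_iff {M : I → J → Prop} {α : Type*} [Fintype α]
    (r : α → I) (c : α → J) (h : ∀ a b, M (r a) (c b) ↔ a = b) :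
    HasMim M (Fintype.card α) := by
  let e := (Fintype.equivFin α).symm
  refine ⟨r ∘ e, c ∘ e, fun i j hij => ?_, fun i j hij => ?_, fun i j => ?_⟩
  · have hr : r (e i) = r (e j) := hij
    exact e.injective ((h _ _).1 (hr ▸ (h (e j) (e j)).2 rfl))
  · have hc : c (e i) = c (e j) := hij
    exact e.injective ((h _ _).1 (hc ▸ (h (e i) (e i)).2 rfl))
  · simp [h]

theorem HasMim.le_card [Fintype I] {M : I → J → Prop} {m : ℕ} (h : HasMim M m) :
    m ≤ Fintype.card I := by
  obtain ⟨r, _, hr, _⟩ := h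
  simpa using Fintype.card_le_of_injective r hr

theorem bddAbove_setOf_hasMim [Fintype I] (M : I → J → Prop) : BddAbove {m | HasMim M m} :=
  ⟨Fintype.card I, fun _ h => h.le_card⟩

theorem HasMim.le_mim [Fintype I] {M : I → J → Prop} {m : ℕ} (h : HasMim M m) : m ≤ mim M :=
  le_csSup (bddAbove_setOf_hasMim M) h

theorem hasMim_mim [Fintype I] (M : I → J → Prop) : HasMim M (mim M) :=
  Nat.sSup_mem (s := {m | HasMim M m})
    ⟨0, Fin.elim0, Fin.elim0, fun i => i.elim0, fun i => i.elim0, fun i => i.elim0⟩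
    (bddAbove_setOf_hasMim M)

theorem HasMim.kronPow_mul {M : I → J → Prop} {k m : ℕ} (h : HasMim (kronPow M k) m) (n : ℕ) :
    HasMim (kronPow M (n * k)) (m ^ n) := by
  obtain ⟨r, c, -, -, h⟩ := h
  have key := hasMim_card_of_forall_iff (M := kronPow M (n * k)) (α := Fin n → Fin m)
    (fun f t => r (f (finProdFinEquiv.symm t).1) (finProdFinEquiv.symm t).2)
    (fun f t => c (f (finProdFinEquiv.symm t).1) (finProdFinEquiv.symm t).2) ?_
  · simpa using key
  · intro f g
    refine ⟨fun hfg => funext fun i => (h _ _).1 fun t => ?_, ?_⟩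
    · simpa using hfg (finProdFinEquiv (i, t))
    · rintro rfl t
      exact (h _ _).2 rfl _

theorem mim_kronPow_pow_le [Fintype I] (M : I → J → Prop) (n k : ℕ) :
    mim (kronPow M k) ^ n ≤ mim (kronPow M (n * k)) :=
  ((hasMim_mim _).kronPow_mul n).le_mim

theorem mim_kronPow_rpow_le_card [Fintype I] (M : I → J → Prop) {k : ℕ} (hk : k ≠ 0) :
    (mim (kronPow M k) : ℝ) ^ (1 / (k : ℝ)) ≤ Fintype.card I := by
  have h : (mim (kronPow M k) : ℝ) ≤ (Fintype.card I : ℝ) ^ k := by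
    exact_mod_cast (hasMim_mim (kronPow M k)).le_card.trans_eq (by simp)
  calc (mim (kronPow M k) : ℝ) ^ (1 / (k : ℝ))
      ≤ ((Fintype.card I : ℝ) ^ k) ^ (1 / (k : ℝ)) := by gcongr
    _ = Fintype.card I := by
      rw [one_div, Real.pow_rpow_inv_natCast (by positivity) hk]

theorem mim_kronPow_rpow_le_mimsup [Fintype I] (M : I → J → Prop) {k : ℕ} (hk : k ≠ 0) :
    (mim (kronPow M k) : ℝ) ^ (1 / (k : ℝ)) ≤ mimsup M := by
  refine le_limsup_of_frequently_le (frequently_atTop.2 fun a => ?_) ?_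
  · refine ⟨(a + 1) * k, ?_, ?_⟩
    · exact (Nat.le_succ a).trans (Nat.le_mul_of_pos_right _ (Nat.pos_of_ne_zero hk))
    · have h : (mim (kronPow M k) : ℝ) ^ (a + 1) ≤ mim (kronPow M ((a + 1) * k)) := by
        exact_mod_cast mim_kronPow_pow_le M (a + 1) k
      calc (mim (kronPow M k) : ℝ) ^ (1 / (k : ℝ))
          = ((mim (kronPow M k) : ℝ) ^ (a + 1)) ^ (1 / (((a + 1) * k : ℕ) : ℝ)) := by
            rw [← Real.rpow_natCast, ← Real.rpow_mul (by positivity)]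
            congr 1
            push_cast
            field_simp
        _ ≤ _ := by gcongr
  · refine isBoundedUnder_of_eventually_le (a := (Fintype.card I : ℝ)) ?_
    filter_upwards [eventually_ne_atTop 0] with n hn using mim_kronPow_rpow_le_card M hn

theorem mim_kronPow_le_mimsup_pow [Fintype I] (M : I → J → Prop) {k : ℕ} (hk : k ≠ 0) :
    (mim (kronPow M k) : ℝ) ≤ mimsup M ^ k := by
  calc (mim (kronPow M k) : ℝ) = ((mim (kronPow M k) : ℝ) ^ (1 / (k : ℝ))) ^ k := by
        rw [one_div, Real.rpow_inv_natCast_pow (by positivity) hk]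
    _ ≤ mimsup M ^ k := by
      gcongr
      exact mim_kronPow_rpow_le_mimsup M hk

/-- In an inclusion-minimal representing set every row has a private column, so the set is the row
set of an induced matching. -/
theorem exists_represents_ncard_le_mim [Fintype I] (M : I → J → Prop) (𝒜 : Set I) :
    ∃ 𝒜' : Set I, Represents M 𝒜 𝒜' ∧ 𝒜'.ncard ≤ mim M := by
  obtain ⟨S, hS⟩ := (Set.toFinite {S | Represents M 𝒜 S}).exists_minimal
    ⟨𝒜, subset_rfl, fun _ h => h⟩
  refine ⟨S, hS.prop, ?_⟩
  have hpriv : ∀ a : S, ∃ j, M a j ∧ ∀ b ∈ S, M b j → b = a := by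
    rintro ⟨a, ha⟩
    by_contra! hcon
    have hrep : Represents M 𝒜 (S \ {a}) := by
      refine ⟨Set.sdiff_subset.trans hS.prop.1, fun j hj => ?_⟩
      obtain ⟨b, hb, hbj⟩ := hS.prop.2 j hj
      by_cases hba : b = a
      · obtain ⟨b', hb', hbj', hne⟩ := hcon j (hba ▸ hbj)
        exact ⟨b', ⟨hb', hne⟩, hbj'⟩
      · exact ⟨b, ⟨hb, hba⟩, hbj⟩
    exact (hS.le_of_le hrep Set.sdiff_subset ha).2 rfl
  choose c hc hcS using hpriv
  have := Fintype.ofFinite S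
  have h := hasMim_card_of_forall_iff (M := M) (fun a : S => (a : I)) c fun a b =>
    ⟨fun hab => Subtype.ext (hcS b a a.2 hab), fun hab => hab ▸ hc a⟩
  rw [← Nat.card_coe_set_eq, Nat.card_eq_fintype_card]
  exact h.le_mim

end InducedMatchings

theorem stmt0 {V : Type} [Fintype V] (H : SimpleGraph V) (hH : ¬ H.Colorable 2)
    (k : ℕ) (hk : 1 ≤ k) (𝒜 : Set (Fin k → V)) :
    ∃ 𝒜' : Set (Fin k → V), Represents (kronPow H.Adj k) 𝒜 𝒜' ∧
      𝒜'.ncard ≤ mim (kronPow H.Adj k) ∧ (𝒜'.ncard : ℝ) ≤ mimsup H.Adj ^ k := by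
  obtain ⟨𝒜', hrep, hcard⟩ := exists_represents_ncard_le_mim (kronPow H.Adj k) 𝒜
  exact ⟨𝒜', hrep, hcard, (Nat.cast_le.2 hcard).trans
    (mim_kronPow_le_mimsup_pow H.Adj (Nat.one_le_iff_ne_zero.1 hk))⟩
end

section
/- Let k ≥ 2 and ℓ_1,…,ℓ_k ≥ 1 be integers, let A ∈ {0,1}^{h×h}, and let 𝒜 ⊆ [h]^k satisfy |𝒜| ≥ g_k(ℓ_1,…,ℓ_k), where g_k(ℓ_1,…,ℓ_k) is the multinomial coefficient (ℓ_1+…+ℓ_k choose ℓ_1,…,ℓ_k). Suppose that for every i ∈ [k], letting R_i = { r_i : r ∈ 𝒜 } be the set of i-th coordinates of tuples in 𝒜 and A[R_i,·] the submatrix of A on the rows R_i, we have him(A[R_i,·]) < ℓ_i. Then there exists v ∈ 𝒜 such that 𝒜 \ {v} A^{⊗k}-represents 𝒜. -/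
open Filter

theorem multinomial_eq_sum_update_pred {ι : Type*} [Fintype ι] [DecidableEq ι] [Nonempty ι]
    (ℓ : ι → ℕ) (hℓ : ∀ t, 1 ≤ ℓ t) :
    Nat.multinomial Finset.univ ℓ =
      ∑ t, Nat.multinomial Finset.univ (Function.update ℓ t (ℓ t - 1)) := by
  have hpos : 0 < ∏ t, (ℓ t).factorial := Finset.prod_pos fun t _ => Nat.factorial_pos _
  apply Nat.eq_of_mul_eq_mul_left hpos
  rw [Nat.multinomial_spec, Finset.mul_sum]
  have hterm : ∀ t, (∏ s, (ℓ s).factorial) *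
      Nat.multinomial Finset.univ (Function.update ℓ t (ℓ t - 1)) =
        ℓ t * (∑ s, ℓ s - 1).factorial := by
    intro t
    have hspec := Nat.multinomial_spec Finset.univ (Function.update ℓ t (ℓ t - 1))
    have hsum : ∑ s, Function.update ℓ t (ℓ t - 1) s = ∑ s, ℓ s - 1 := by
      rw [Finset.sum_update_of_mem (Finset.mem_univ t),
        ← Finset.add_sum_erase Finset.univ ℓ (Finset.mem_univ t), Finset.erase_eq]
      have := hℓ t
      omega
    have hprod : ∏ s, (ℓ s).factorial =
        ℓ t * ∏ s, (Function.update ℓ t (ℓ t - 1) s).factorial := by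
      rw [← Finset.mul_prod_erase Finset.univ _ (Finset.mem_univ t),
        ← Finset.mul_prod_erase Finset.univ
          (fun s => (Function.update ℓ t (ℓ t - 1) s).factorial) (Finset.mem_univ t),
        ← mul_assoc, Function.update_self, Nat.mul_factorial_pred (by have := hℓ t; omega)]
      congr 1
      refine Finset.prod_congr rfl fun s hs => ?_
      rw [Function.update_of_ne (Finset.ne_of_mem_erase hs)]
    rw [hprod, mul_assoc, hspec, hsum]
  simp_rw [hterm]
  rw [← Finset.sum_mul]
  have hne : ∑ s, ℓ s ≠ 0 := by
    obtain ⟨t⟩ := ‹Nonempty ι›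
    have := Finset.single_le_sum (f := ℓ) (fun _ _ => Nat.zero_le _) (Finset.mem_univ t)
    have := hℓ t
    omega
  exact (Nat.mul_factorial_pred hne).symm

/-- A Ramsey-type bound: if any two distinct elements of `S` are separated by one of the
relations `E t`, and chains for the complement of `E t` in `S` are shorter than `ℓ t`, then `S` has
fewer elements than the multinomial coefficient of `ℓ`. -/
theorem card_lt_multinomial_of_chain_length_lt {ι V : Type*} [Fintype ι] [DecidableEq ι]
    (hι : 2 ≤ Fintype.card ι) (E : ι → V → V → Prop) (S : Finset V) (ℓ : ι → ℕ)
    (hE : ∀ v ∈ S, ∀ w ∈ S, v ≠ w → ∃ t, ¬ E t v w)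
    (hchain : ∀ t, ∀ l : List V, (∀ x ∈ l, x ∈ S) → l.Pairwise (fun x y => ¬ E t x y) →
      l.length < ℓ t) :
    S.card < Nat.multinomial Finset.univ ℓ := by
  classical
  induction S using Finset.strongInduction generalizing ℓ with
  | H S ih =>
    rcases S.eq_empty_or_nonempty with rfl | ⟨v, hv⟩
    · simpa using Nat.multinomial_pos Finset.univ ℓ
    have hℓ : ∀ t, 1 ≤ ℓ t := fun t => Nat.succ_le_of_lt (hchain t [] (by simp) (by simp))
    have : Nonempty ι := Fintype.card_pos_iff.mp (by omega)
    let C : ι → Finset V := fun t => (S.erase v).filter fun w => ¬ E t v w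
    have hCS : ∀ t, C t ⊆ S.erase v := fun t => Finset.filter_subset _ _
    have hmem : ∀ t, ∀ w ∈ C t, w ∈ S := fun t w hw => Finset.mem_of_mem_erase (hCS t hw)
    have hC : ∀ t, (C t).card + 1 ≤
        Nat.multinomial Finset.univ (Function.update ℓ t (ℓ t - 1)) := by
      intro t
      refine ih (C t) ((hCS t).trans_ssubset (Finset.erase_ssubset hv)) _
        (fun x hx y hy => hE x (hmem t x hx) y (hmem t y hy)) ?_
      intro s l hl hp
      by_cases hst : s = t
      · subst hst
        have := hchain s (v :: l)
          (by simpa [hv] using fun x hx => hmem s x (hl x hx))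
          (List.pairwise_cons.mpr ⟨fun x hx => (Finset.mem_filter.mp (hl x hx)).2, hp⟩)
        simp only [List.length_cons] at this
        rw [Function.update_self]
        omega
      · rw [Function.update_of_ne hst]
        exact hchain s l (fun x hx => hmem t x (hl x hx)) hp
    have hcover : S.erase v ⊆ Finset.univ.biUnion C := by
      intro w hw
      obtain ⟨t, ht⟩ := hE v hv w (Finset.mem_of_mem_erase hw) (Finset.ne_of_mem_erase hw).symm
      exact Finset.mem_biUnion.mpr ⟨t, Finset.mem_univ t, Finset.mem_filter.mpr ⟨hw, ht⟩⟩
    have hle := (Finset.card_le_card hcover).trans Finset.card_biUnion_le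
    have hsum := Finset.sum_le_sum fun t (_ : t ∈ Finset.univ) => hC t
    rw [← multinomial_eq_sum_update_pred ℓ hℓ, Finset.sum_add_distrib] at hsum
    simp only [Finset.sum_const, Finset.card_univ, smul_eq_mul, mul_one] at hsum
    have := Finset.card_erase_add_one hv
    omega

theorem HasHim.le_him {I J : Type*} [Fintype I] {M : I → J → Prop} {m : ℕ} (hm : HasHim M m) :
    m ≤ him M := by
  refine le_csSup ⟨Fintype.card I, ?_⟩ hm
  rintro n ⟨r, _, hr, _⟩
  simpa using Fintype.card_le_of_injective r hr

/-- A list of row-column pairs, each column vanishing on the later rows, is a half-induced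
matching. -/
theorem hasHim_of_pairwise {I J : Type*} {M : I → J → Prop} (l : List (I × J))
    (hdiag : ∀ p ∈ l, M p.1 p.2) (hp : l.Pairwise fun p q => ¬ M q.1 p.2) :
    HasHim M l.length := by
  let r : Fin l.length → I := fun i => (l.get i.rev).1
  let c : Fin l.length → J := fun i => (l.get i.rev).2
  have hd : ∀ i, M (r i) (c i) := fun i => hdiag _ (l.get_mem _)
  have hz : ∀ i j, i < j → ¬ M (r i) (c j) := fun i j hij =>
    List.pairwise_iff_get.mp hp j.rev i.rev (Fin.rev_lt_rev.mpr hij)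
  refine ⟨r, c, ?_, ?_, hd, hz⟩
  · intro i j hij
    rcases lt_trichotomy i j with hlt | heq | hlt
    · exact absurd (hij ▸ hd j) (hz i j hlt)
    · exact heq
    · exact absurd (hij ▸ hd i) (hz j i hlt)
  · intro i j hij
    rcases lt_trichotomy i j with hlt | heq | hlt
    · exact absurd (hij ▸ hd i) (hz i j hlt)
    · exact heq
    · exact absurd (hij ▸ hd j) (hz j i hlt)

theorem stmt2 {h : ℕ} (k : ℕ) (hk : 2 ≤ k) (ℓ : Fin k → ℕ) (hℓ : ∀ i, 1 ≤ ℓ i)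
    (A : Fin h → Fin h → Prop) (𝒜 : Set (Fin k → Fin h))
    (hcard : Nat.multinomial Finset.univ ℓ ≤ 𝒜.ncard)
    (hhim : ∀ i : Fin k,
      him (fun (x : {a : Fin h // ∃ r ∈ 𝒜, r i = a}) (j : Fin h) => A x.1 j) < ℓ i) :
    ∃ v ∈ 𝒜, Represents (kronPow A k) 𝒜 (𝒜 \ {v}) := by
  classical
  by_contra! hcon
  have hcol : ∀ v ∈ 𝒜, ∃ c, kronPow A k v c ∧ ∀ w ∈ 𝒜, v ≠ w → ¬ kronPow A k w c := by
    intro v hv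
    by_contra! hv'
    refine hcon v hv ⟨Set.sdiff_subset, ?_⟩
    rintro c ⟨w, hw, hwc⟩
    by_cases hwv : w = v
    · subst hwv
      obtain ⟨u, hu, hne, huc⟩ := hv' c hwc
      exact ⟨u, ⟨hu, hne.symm⟩, huc⟩
    · exact ⟨w, ⟨hw, hwv⟩, hwc⟩
  choose! c hc hc' using hcol
  refine absurd hcard (not_le.mpr ?_)
  rw [Set.ncard_eq_toFinset_card']
  refine card_lt_multinomial_of_chain_length_lt (by simpa using hk)
    (fun t v w => A (w t) (c v t)) 𝒜.toFinset ℓ ?_ ?_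
  · intro v hv w hw hvw
    simpa [kronPow] using hc' v (by simpa using hv) w (by simpa using hw) hvw
  · intro t l hl hp
    have hl' : ∀ x ∈ l, x ∈ 𝒜 := fun x hx => by simpa using hl x hx
    refine lt_of_le_of_lt (HasHim.le_him ?_) (hhim t)
    have := hasHim_of_pairwise
      (M := fun (x : {a : Fin h // ∃ r ∈ 𝒜, r t = a}) (j : Fin h) => A x.1 j)
      (l.attach.map fun x => (⟨x.1 t, x.1, hl' x.1 x.2, rfl⟩, c x.1 t))
      (by
        simp only [List.mem_map, forall_exists_index, and_imp]
        rintro _ x - rfl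
        exact hc x.1 (hl' x.1 x.2) t)
      (by
        rw [← List.attach_map_subtype_val l, List.pairwise_map] at hp
        exact List.pairwise_map.mpr hp)
    simpa using this
end

section
/- Let A ∈ {0,1}^{n×n}, let F be a field, and let B ∈ F^{n×n} be a matrix with the same support as A. Then for every k ∈ ℕ, mim(A^{⊗k}) ≤ rank_F(B^{⊗k}) = rank_F(B)^k. In particular, mimsup(A) is at most the support-rank of A over F. -/
open Filter

/-- `B` has the same support as the 0/1 matrix `A`. -/
def SameSupport {I J F : Type*} [Zero F] (B : Matrix I J F) (A : I → J → Prop) : Prop :=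
  ∀ i j, B i j = 0 ↔ ¬ A i j

/-- `k`-fold Kronecker power of a matrix over a commutative ring. -/
def matKronPow {I J F : Type*} [CommMonoid F] (B : Matrix I J F) (k : ℕ) :
    Matrix (Fin k → I) (Fin k → J) F :=
  fun r c => ∏ t, B (r t) (c t)

/-- The support-rank of the 0/1 matrix `A` over the field `F`. -/
noncomputable def supportRank (F : Type*) [Field F] {I J : Type*} [Fintype I] [Fintype J]
    (A : I → J → Prop) : ℕ :=
  sInf {r | ∃ B : Matrix I J F, SameSupport B A ∧ B.rank = r}

section MatKronPow

variable {I J K F : Type*}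

theorem matKronPow_mul [Fintype J] [CommSemiring F] (M : Matrix I J F) (N : Matrix J K F)
    (k : ℕ) : matKronPow (M * N) k = matKronPow M k * matKronPow N k := by
  classical
  ext r c
  simp only [matKronPow, Matrix.mul_apply, ← Finset.prod_mul_distrib]
  rw [Finset.prod_univ_sum, Fintype.piFinset_univ]

theorem matKronPow_diagonal [DecidableEq I] [CommSemiring F] (d : I → F) (k : ℕ) :
    matKronPow (Matrix.diagonal d) k = Matrix.diagonal fun r : Fin k → I => ∏ t, d (r t) := by
  ext r c
  by_cases h : r = c
  · subst h
    simp [matKronPow]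
  · obtain ⟨t, ht⟩ := Function.ne_iff.mp h
    rw [Matrix.diagonal_apply_ne _ h]
    exact Finset.prod_eq_zero (Finset.mem_univ t) (Matrix.diagonal_apply_ne _ ht)

theorem matKronPow_one [DecidableEq I] [CommSemiring F] (k : ℕ) :
    matKronPow (1 : Matrix I I F) k = 1 := by
  rw [← Matrix.diagonal_one, matKronPow_diagonal]
  simp

theorem isUnit_matKronPow [Fintype I] [DecidableEq I] [CommSemiring F] {M : Matrix I I F}
    (hM : IsUnit M) (k : ℕ) : IsUnit (matKronPow M k) := by
  obtain ⟨u, rfl⟩ := hM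
  refine ⟨⟨matKronPow (u : Matrix I I F) k, matKronPow (↑u⁻¹ : Matrix I I F) k, ?_, ?_⟩, rfl⟩ <;>
    simp [← matKronPow_mul, matKronPow_one]

theorem rank_mul_mul_of_isUnit [Fintype I] [DecidableEq I] [CommRing F] {P Q : Matrix I I F}
    (hP : IsUnit P) (hQ : IsUnit Q) (M : Matrix I I F) : (P * M * Q).rank = M.rank := by
  rw [Matrix.rank_mul_eq_left_of_isUnit_det _ _ ((Matrix.isUnit_iff_isUnit_det _).1 hQ),
    Matrix.rank_mul_eq_right_of_isUnit_det _ _ ((Matrix.isUnit_iff_isUnit_det _).1 hP)]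

theorem rank_matKronPow [Fintype I] [DecidableEq I] [Field F] (M : Matrix I I F) (k : ℕ) :
    (matKronPow M k).rank = M.rank ^ k := by
  classical
  obtain ⟨L, L', D, h⟩ := Matrix.Pivot.exists_list_transvec_mul_diagonal_mul_list_transvec M
  have hL (L : List (Matrix.TransvectionStruct I F)) :
      IsUnit (L.map Matrix.TransvectionStruct.toMatrix).prod := by
    simp [Matrix.isUnit_iff_isUnit_det]
  rw [h, matKronPow_mul, matKronPow_mul, rank_mul_mul_of_isUnit (hL L) (hL L'),
    rank_mul_mul_of_isUnit (isUnit_matKronPow (hL L) k) (isUnit_matKronPow (hL L') k),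
    matKronPow_diagonal, Matrix.rank_diagonal, Matrix.rank_diagonal]
  simp only [ne_eq, Finset.prod_eq_zero_iff, Finset.mem_univ, true_and, not_exists]
  rw [Fintype.card_congr (Equiv.subtypePiEquivPi (p := fun (_ : Fin k) i => ¬ D i = 0))]
  simp

end MatKronPow

section Support

variable {I J F : Type*} [Field F]

theorem SameSupport.matKronPow {B : Matrix I J F} {A : I → J → Prop} (hB : SameSupport B A)
    (k : ℕ) : SameSupport (matKronPow B k) (kronPow A k) := by
  intro r c
  simp [_root_.matKronPow, kronPow, Finset.prod_eq_zero_iff, hB _ _]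

theorem SameSupport.mim_le_rank [Fintype J] {B : Matrix I J F} {A : I → J → Prop}
    (hB : SameSupport B A) : mim A ≤ B.rank := by
  classical
  refine csSup_le' ?_
  rintro m ⟨r, c, -, -, h⟩
  have hd : B.submatrix r c = Matrix.diagonal fun i => B (r i) (c i) := by
    ext i j
    by_cases hij : i = j
    · subst hij
      simp
    · simpa [hij] using (hB (r i) (c j)).2 (mt (h i j).1 hij)
  have hne (i : Fin m) : B (r i) (c i) ≠ 0 := by
    simp [hB (r i) (c i), h]
  have hrank := B.rank_submatrix_le r c
  rw [hd, Matrix.rank_diagonal] at hrank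
  simpa [hne] using hrank

theorem SameSupport.mim_kronPow_le [Fintype I] [DecidableEq I] {B : Matrix I I F}
    {A : I → I → Prop} (hB : SameSupport B A) (k : ℕ) : mim (kronPow A k) ≤ B.rank ^ k :=
  (hB.matKronPow k).mim_le_rank.trans_eq (rank_matKronPow B k)

theorem SameSupport.mimsup_le_rank [Fintype I] [DecidableEq I] {B : Matrix I I F}
    {A : I → I → Prop} (hB : SameSupport B A) : mimsup A ≤ B.rank := by
  refine limsup_le_of_le (isCoboundedUnder_le_of_le atTop (x := 0) fun k => by positivity) ?_
  filter_upwards [eventually_ne_atTop 0] with k hk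
  calc (mim (kronPow A k) : ℝ) ^ (1 / (k : ℝ))
      ≤ ((B.rank : ℝ) ^ k) ^ (1 / (k : ℝ)) := by
        gcongr
        exact_mod_cast hB.mim_kronPow_le k
    _ = B.rank := by
        rw [one_div, Real.pow_rpow_inv_natCast (Nat.cast_nonneg _) hk]

end Support

theorem stmt12 {n : ℕ} (F : Type) [Field F] (A : Fin n → Fin n → Prop)
    (B : Matrix (Fin n) (Fin n) F) (hB : SameSupport B A) :
    (∀ k : ℕ, mim (kronPow A k) ≤ (matKronPow B k).rank ∧
      (matKronPow B k).rank = B.rank ^ k) ∧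
    mimsup A ≤ (supportRank F A : ℝ) := by
  refine ⟨fun k => ⟨(hB.matKronPow k).mim_le_rank, rank_matKronPow B k⟩, ?_⟩
  obtain ⟨B', hB', hr⟩ := Nat.sInf_mem (s := {r | ∃ B : Matrix (Fin n) (Fin n) F,
    SameSupport B A ∧ B.rank = r}) ⟨_, B, hB, rfl⟩
  rw [supportRank, ← hr]
  exact hB'.mimsup_le_rank
end

section
/- For each field F and each integer t ≥ 3, for all sufficiently large n there exists a symmetric matrix A ∈ {0,1}^{n×n} (with ones on the diagonal) such that him(A) ≤ 2t and every matrix B ∈ F^{n×n} with the same support as A has rank at least n^{1−2/t}. -/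
open Filter

section ZeroPatterns

open MvPolynomial

/-- Linearly independent polynomials of total degree at most `D` in the variables `σ` number at
most `(D + 1) ^ |σ|`. -/
lemma card_le_of_linearIndependent_of_totalDegree_le {σ κ F : Type*} [Fintype σ] [Fintype κ]
    [Field F] (g : κ → MvPolynomial σ F) (hg : LinearIndependent F g) (D : ℕ)
    (hD : ∀ k, (g k).totalDegree ≤ D) :
    Fintype.card κ ≤ (D + 1) ^ Fintype.card σ := by
  classical
  set φ : (σ → Fin (D + 1)) → MvPolynomial σ F := fun e =>
    monomial (Finsupp.equivFunOnFinite.symm fun i => (e i : ℕ)) 1 with hφ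
  have hspan : Set.range g ≤ Submodule.span F (Set.range φ) := by
    rintro _ ⟨k, rfl⟩
    rw [SetLike.mem_coe, (g k).as_sum]
    refine Submodule.sum_mem _ fun v hv => ?_
    have hv' : ∀ i, v i < D + 1 := fun i =>
      Nat.lt_succ_of_le (((Finsupp.le_degree i v).trans (le_totalDegree hv)).trans (hD k))
    have : monomial v (coeff v (g k)) = coeff v (g k) • φ fun i => ⟨v i, hv' i⟩ := by
      rw [hφ, smul_monomial, smul_eq_mul, mul_one]
      congr 1
      ext i
      simp
    rw [this]
    exact Submodule.smul_mem _ _ (Submodule.subset_span ⟨_, rfl⟩)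
  calc Fintype.card κ ≤ Fintype.card (Set.range φ) :=
        linearIndependent_le_span_aux' g hg (Set.range φ) hspan
    _ ≤ Fintype.card (σ → Fin (D + 1)) := Fintype.card_range_le φ
    _ = (D + 1) ^ Fintype.card σ := by simp

/-- A bound on the number of zero patterns of a family of polynomials: the sets `S` of indices at
which the family is exactly nonzero, as the variables range over the field. -/
lemma card_zeroPatterns_le {σ ι F : Type*} [Fintype σ] [Fintype ι] [Field F]
    (f : ι → MvPolynomial σ F) (d : ℕ) (hd : ∀ i, (f i).totalDegree ≤ d)
    (𝒵 : Finset (Finset ι)) (h𝒵 : ∀ S ∈ 𝒵, ∃ x : σ → F, ∀ i, i ∈ S ↔ eval x (f i) ≠ 0) :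
    𝒵.card ≤ (Fintype.card ι * d + 1) ^ Fintype.card σ := by
  classical
  choose x hx using h𝒵
  set g : 𝒵 → MvPolynomial σ F := fun S => ∏ i ∈ S.1, f i with hg
  have heval : ∀ S T : 𝒵, eval (x T.1 T.2) (g S) ≠ 0 ↔ S.1 ⊆ T.1 := by
    intro S T
    rw [hg, eval_prod, Finset.prod_ne_zero_iff]
    exact ⟨fun h i hi => (hx T.1 T.2 i).2 (h i hi), fun h i hi => (hx T.1 T.2 i).1 (h hi)⟩
  have hli : LinearIndependent F g := by
    rw [Fintype.linearIndependent_iff]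
    intro c hc
    suffices H : ∀ S : Finset ι, ∀ hS : S ∈ 𝒵, c ⟨S, hS⟩ = 0 from fun S => H S.1 S.2
    intro S
    induction S using Finset.strongInduction with
    | H S ih =>
      intro hS
      have h0 := congrArg (eval (x S hS)) hc
      rw [map_sum, map_zero, Finset.sum_eq_single ⟨S, hS⟩] at h0
      · rw [smul_eval] at h0
        exact (mul_eq_zero.1 h0).resolve_right ((heval ⟨S, hS⟩ ⟨S, hS⟩).2 subset_rfl)
      · intro T _ hT
        rw [smul_eval]
        by_cases hTS : T.1 ⊆ S
        · rw [ih T.1 (hTS.ssubset_of_ne fun h => hT (Subtype.ext h)) T.2, zero_mul]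
        · have := (heval T ⟨S, hS⟩).not.2 hTS
          rw [not_not] at this
          rw [this, mul_zero]
      · simp
  rw [← Fintype.card_coe]
  refine card_le_of_linearIndependent_of_totalDegree_le g hli _ fun S => ?_
  calc (g S).totalDegree ≤ ∑ i ∈ S.1, (f i).totalDegree := totalDegree_finsetProd _ _
    _ ≤ ∑ _i ∈ S.1, d := Finset.sum_le_sum fun i _ => hd i
    _ = S.1.card * d := by simp
    _ ≤ Fintype.card ι * d := Nat.mul_le_mul_right _ (Finset.card_le_univ _)

end ZeroPatterns

section LowRank

/-- A matrix of rank at most `R` factors through a space of dimension `R`. -/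
lemma exists_eq_mul_of_rank_le {m n : Type*} [Fintype m] [Fintype n] [DecidableEq n]
    {F : Type*} [Field F] (B : Matrix m n F) {R : ℕ} (h : B.rank ≤ R) :
    ∃ (U : Matrix m (Fin R) F) (V : Matrix (Fin R) n F), B = U * V := by
  let W := LinearMap.range B.mulVecLin
  have hW : Module.finrank F W = B.rank := rfl
  let b := Module.finBasis F W
  obtain ⟨d, rfl⟩ := Nat.exists_eq_add_of_le (hW.le.trans h)
  let w : n → W := fun j => ⟨B.mulVecLin (Pi.single j 1), LinearMap.mem_range_self _ _⟩
  refine ⟨Matrix.of fun i => Fin.append (fun k => (b k : m → F) i) 0,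
    Matrix.of fun k j => Fin.append (fun k => b.repr (w j) k) (0 : Fin d → F) k, ?_⟩
  ext i j
  have h1 := congrArg (fun v : W => (v : m → F) i) (b.sum_repr (w j))
  have h2 : ((w j : W) : m → F) i = B i j := by simp [w]
  simp only [h2] at h1
  rw [Matrix.mul_apply, Fin.sum_univ_add, ← h1]
  simp only [AddSubmonoidClass.coe_finsetSum, Submodule.coe_smul, Finset.sum_apply,
    Pi.smul_apply, smul_eq_mul]
  simp [mul_comm]

/-- The number of supports of `n × n` matrices of rank at most `R` over a field. -/
lemma card_supports_of_rank_le (F : Type*) [Field F] (n R : ℕ)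
    (Ps : Finset (Fin n → Fin n → Prop))
    (hPs : ∀ A ∈ Ps, ∃ B : Matrix (Fin n) (Fin n) F, SameSupport B A ∧ B.rank ≤ R) :
    Ps.card ≤ (2 * n ^ 2 + 1) ^ (2 * n * R) := by
  classical
  let f : Fin n × Fin n → MvPolynomial ((Fin n × Fin R) ⊕ (Fin R × Fin n)) F := fun p =>
    ∑ k, MvPolynomial.X (Sum.inl (p.1, k)) * MvPolynomial.X (Sum.inr (k, p.2))
  have hf : ∀ p, (f p).totalDegree ≤ 2 := by
    intro p
    refine MvPolynomial.totalDegree_finsetSum_le fun k _ => ?_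
    refine (MvPolynomial.totalDegree_mul _ _).trans ?_
    simp [MvPolynomial.totalDegree_X]
  let ψ : (Fin n → Fin n → Prop) → Finset (Fin n × Fin n) := fun A =>
    Finset.univ.filter fun p => A p.1 p.2
  have hψ : Function.Injective ψ := by
    intro A A' h
    funext i j
    have := congrArg (fun S => (i, j) ∈ S) h
    simpa [ψ] using this
  have key := card_zeroPatterns_le f 2 hf (Ps.image ψ) (by
    intro S hS
    obtain ⟨A, hA, rfl⟩ := Finset.mem_image.1 hS
    obtain ⟨B, hB, hr⟩ := hPs A hA
    obtain ⟨U, V, rfl⟩ := exists_eq_mul_of_rank_le B hr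
    refine ⟨Sum.elim (fun q => U q.1 q.2) (fun q => V q.1 q.2), fun p => ?_⟩
    have h1 : MvPolynomial.eval (Sum.elim (fun q => U q.1 q.2) (fun q => V q.1 q.2)) (f p) =
        (U * V) p.1 p.2 := by
      simp [f, Matrix.mul_apply]
    rw [h1, ne_eq, hB, not_not]
    simp [ψ])
  rw [Finset.card_image_of_injective _ hψ] at key
  refine key.trans (le_of_eq ?_)
  simp only [Fintype.card_prod, Fintype.card_sum, Fintype.card_fin]
  congr 1 <;> ring

end LowRank

section Coloring

/-- The unordered pairs of distinct elements of `V`. -/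
abbrev Sym2.OffDiag (V : Type*) := {z : Sym2 V // ¬ z.IsDiag}

/-- The symmetric 0/1 matrix with ones on the diagonal whose zeros are the pairs of colour `c`. -/
def colorMatrix {V κ : Type*} (f : Sym2.OffDiag V → κ) (c : κ) (i j : V) : Prop :=
  ∀ h : ¬ (s(i, j) : Sym2 V).IsDiag, f ⟨s(i, j), h⟩ ≠ c

lemma colorMatrix_self {V κ : Type*} (f : Sym2.OffDiag V → κ) (c : κ) (i : V) :
    colorMatrix f c i i := fun h => absurd (Sym2.mk_isDiag_iff.2 rfl) h

lemma colorMatrix_comm {V κ : Type*} (f : Sym2.OffDiag V → κ) (c : κ) (i j : V) :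
    colorMatrix f c i j ↔ colorMatrix f c j i := by
  unfold colorMatrix
  rw [Sym2.eq_swap]

lemma colorMatrix_injective {V κ : Type*} :
    Function.Injective (colorMatrix : (Sym2.OffDiag V → κ) → κ → V → V → Prop) := by
  intro f g h
  funext ⟨z, hz⟩
  induction z using Sym2.ind with
  | _ i j =>
    by_contra hne
    have h1 : colorMatrix g (f ⟨s(i, j), hz⟩) i j := fun _ h' => hne h'.symm
    rw [← h] at h1
    exact h1 hz rfl

/-- The number of colourings that are constant on a given set. -/
lemma card_filter_const_on_mul {E κ : Type*} [Fintype E] [DecidableEq E] [Fintype κ]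
    [DecidableEq κ] (T : Finset E) (c : κ) :
    (Finset.univ.filter fun f : E → κ => ∀ x ∈ T, f x = c).card * Fintype.card κ ^ T.card =
      Fintype.card κ ^ Fintype.card E := by
  have h : (Finset.univ.filter fun f : E → κ => ∀ x ∈ T, f x = c) =
      Fintype.piFinset fun x => if x ∈ T then {c} else Finset.univ := by
    ext f
    simp only [Finset.mem_filter, Finset.mem_univ, true_and, Fintype.mem_piFinset]
    refine forall_congr' fun x => ?_
    by_cases hx : x ∈ T <;> simp [hx]
  have h2 : ∀ x, (if x ∈ T then ({c} : Finset κ) else Finset.univ).card =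
      if x ∈ T then 1 else Fintype.card κ := by
    intro x
    split_ifs <;> simp
  rw [h, Fintype.card_piFinset, Finset.prod_congr rfl fun x _ => h2 x, Finset.prod_ite]
  simp only [Finset.prod_const, one_pow, one_mul]
  rw [← pow_add, add_comm, ← Finset.card_univ (α := E),
    ← Finset.card_filter_add_card_filter_not (s := Finset.univ) (fun x => x ∈ T)]
  simp

/-- The index pairs on and above the diagonal of an `s × s` matrix. -/
abbrev upperPairs (s : ℕ) : Finset (Fin s × Fin s) := Finset.univ.filter fun p => p.1 ≤ p.2

lemma card_upperPairs_mul_two (s : ℕ) : (upperPairs s).card * 2 = s * (s + 1) := by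
  have h : (upperPairs s).card = ∑ j ∈ Finset.range s, (j + 1) := by
    rw [upperPairs, Finset.card_filter, Fintype.sum_prod_type_right, ← Fin.sum_univ_eq_sum_range]
    refine Finset.sum_congr rfl fun j _ => ?_
    rw [← Finset.card_filter, ← Fin.card_Iic]
    congr 1
    ext k
    simp
  rw [h]
  clear h
  induction s with
  | zero => simp
  | succ s ih =>
    rw [Finset.sum_range_succ, add_mul, ih]
    ring

/-- The zeros of a half-induced matching: rows `a` and columns `b` such that the submatrix
`[a, b]` has colour `c` on and above the diagonal. -/
def IsZeroTriangle {V κ : Type*} {s : ℕ} (f : Sym2.OffDiag V → κ) (c : κ) (a b : Fin s → V) :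
    Prop :=
  Function.Injective a ∧ Function.Injective b ∧
    ∀ k j, k ≤ j → ∃ h : ¬ (s(a k, b j) : Sym2 V).IsDiag, f ⟨s(a k, b j), h⟩ = c

lemma HasHim.exists_isZeroTriangle {V κ : Type*} {f : Sym2.OffDiag V → κ} {c : κ} {s m : ℕ}
    (h : HasHim (colorMatrix f c) m) (hm : s + 1 ≤ m) :
    ∃ a b : Fin s → V, IsZeroTriangle f c a b := by
  obtain ⟨r, q, hr, hq, -, h0⟩ := h
  have hinj := Fin.castLE_injective hm
  refine ⟨fun k => r (Fin.castLE hm k.castSucc), fun k => q (Fin.castLE hm k.succ),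
    hr.comp (hinj.comp (Fin.castSucc_injective s)), hq.comp (hinj.comp (Fin.succ_injective s)),
    fun k j hkj => ?_⟩
  have := h0 (Fin.castLE hm k.castSucc) (Fin.castLE hm j.succ) (by
    rw [Fin.lt_def]
    simpa using Nat.lt_succ_of_le hkj)
  simpa [colorMatrix] using this

/-- The number of colourings in which given rows and columns form a zero triangle. -/
lemma card_isZeroTriangle_mul_le {V κ : Type*} [Fintype V] [DecidableEq V] [Fintype κ]
    [DecidableEq κ] {s : ℕ} (c : κ) (a b : Fin s → V)
    (𝒯 : Finset (Sym2.OffDiag V → κ)) (h𝒯 : ∀ f ∈ 𝒯, IsZeroTriangle f c a b) :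
    𝒯.card * Fintype.card κ ^ (upperPairs s).card ≤
      Fintype.card κ ^ Fintype.card (Sym2.OffDiag V) := by
  obtain rfl | ⟨f₀, hf₀⟩ := 𝒯.eq_empty_or_nonempty
  · simp
  obtain ⟨ha, hb, hd⟩ := h𝒯 f₀ hf₀
  have hdiag : ∀ p ∈ upperPairs s, ¬ (s(a p.1, b p.2) : Sym2 V).IsDiag := fun p hp =>
    (hd p.1 p.2 (Finset.mem_filter.1 hp).2).1
  have hinj : Function.Injective
      (fun p : upperPairs s => (⟨s(a p.1.1, b p.1.2), hdiag p.1 p.2⟩ : Sym2.OffDiag V)) := by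
    rintro ⟨⟨k, j⟩, hp⟩ ⟨⟨k', j'⟩, hp'⟩ h
    have hlt : ∀ x y, a x = b y → y < x := by
      intro x y hxy
      by_contra hle
      exact (hd x y (not_lt.1 hle)).1 (Sym2.mk_isDiag_iff.2 hxy)
    have hkj : k ≤ j := (Finset.mem_filter.1 hp).2
    have hkj' : k' ≤ j' := (Finset.mem_filter.1 hp').2
    simp only [Subtype.mk.injEq, Sym2.eq_iff] at h
    rcases h with ⟨h1, h2⟩ | ⟨h1, h2⟩
    · simp [ha h1, hb h2]
    · have h3 := hlt _ _ h1
      have h4 := hlt _ _ h2.symm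
      exact absurd (h3.trans_le (hkj.trans (h4.le.trans hkj'))) (lt_irrefl _)
  let T : Finset (Sym2.OffDiag V) := Finset.univ.image
    (fun p : upperPairs s => (⟨s(a p.1.1, b p.1.2), hdiag p.1 p.2⟩ : Sym2.OffDiag V))
  have hT : T.card = (upperPairs s).card := by
    rw [Finset.card_image_of_injective _ hinj, Finset.card_univ, Fintype.card_coe]
  rw [← hT, ← card_filter_const_on_mul T c]
  refine Nat.mul_le_mul_right _ (Finset.card_le_card fun f hf => ?_)
  simp only [Finset.mem_filter, Finset.mem_univ, true_and]
  intro x hx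
  obtain ⟨p, -, rfl⟩ := Finset.mem_image.1 hx
  exact ((h𝒯 f hf).2.2 p.1.1 p.1.2 (Finset.mem_filter.1 p.2).2).2

/-- If `K` colours suffice for the two union bounds, some matrix of bounded `him` is not the
support of a matrix of rank at most `R`. -/
lemma exists_him_le_of_card_lt (F : Type*) [Field F] {n s K R : ℕ} (hK : 0 < K)
    (h1 : 2 * (K * n ^ (2 * s)) ≤ K ^ (upperPairs s).card)
    (h2 : 2 * ((2 * n ^ 2 + 1) ^ (2 * n * R)) ^ K < K ^ n.choose 2) :
    ∃ A : Fin n → Fin n → Prop, (∀ i j, A i j ↔ A j i) ∧ (∀ i, A i i) ∧ him A ≤ s ∧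
      ∀ B : Matrix (Fin n) (Fin n) F, SameSupport B A → R < B.rank := by
  classical
  set E := Sym2.OffDiag (Fin n)
  have hE : Fintype.card E = n.choose 2 := by
    rw [Sym2.card_subtype_not_diag, Fintype.card_fin]
  let Ps : Finset (Fin n → Fin n → Prop) := Finset.univ.filter fun A =>
    ∃ B : Matrix (Fin n) (Fin n) F, SameSupport B A ∧ B.rank ≤ R
  have hPs : Ps.card ≤ (2 * n ^ 2 + 1) ^ (2 * n * R) :=
    card_supports_of_rank_le F n R Ps fun A hA => (Finset.mem_filter.1 hA).2
  let low : Finset (E → Fin K) := Finset.univ.filter fun f => ∀ c, colorMatrix f c ∈ Ps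
  have hlow : 2 * low.card < K ^ n.choose 2 := by
    have : low.card ≤ (Fintype.piFinset fun _ : Fin K => Ps).card :=
      Finset.card_le_card_of_injOn colorMatrix
        (fun f hf => Fintype.mem_piFinset.2 (Finset.mem_filter.1 hf).2)
        colorMatrix_injective.injOn
    rw [Fintype.card_piFinset, Finset.prod_const, Finset.card_univ, Fintype.card_fin] at this
    refine lt_of_le_of_lt (Nat.mul_le_mul_left 2 (this.trans (Nat.pow_le_pow_left hPs K))) h2
  let tri : Fin K × (Fin s → Fin n) × (Fin s → Fin n) → Finset (E → Fin K) := fun p =>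
    Finset.univ.filter fun f => IsZeroTriangle f p.1 p.2.1 p.2.2
  have htri : 2 * (Finset.univ.biUnion tri).card ≤ K ^ n.choose 2 := by
    have hsum : (Finset.univ.biUnion tri).card * K ^ (upperPairs s).card ≤
        (K * n ^ (2 * s)) * K ^ n.choose 2 := by
      calc (Finset.univ.biUnion tri).card * K ^ (upperPairs s).card
          ≤ (∑ p, (tri p).card) * K ^ (upperPairs s).card :=
            Nat.mul_le_mul_right _ Finset.card_biUnion_le
        _ = ∑ p, (tri p).card * K ^ (upperPairs s).card := Finset.sum_mul _ _ _
        _ ≤ ∑ _p : Fin K × (Fin s → Fin n) × (Fin s → Fin n), K ^ n.choose 2 := by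
            refine Finset.sum_le_sum fun p _ => ?_
            have := card_isZeroTriangle_mul_le p.1 p.2.1 p.2.2 (tri p)
              fun f hf => (Finset.mem_filter.1 hf).2
            rwa [Fintype.card_fin, hE] at this
        _ = (K * n ^ (2 * s)) * K ^ n.choose 2 := by
            simp only [Finset.sum_const, Finset.card_univ, Fintype.card_prod, Fintype.card_fun,
              Fintype.card_fin, smul_eq_mul]
            rw [two_mul, pow_add]
    have hpos : 0 < K ^ (upperPairs s).card := pow_pos hK _
    refine Nat.le_of_mul_le_mul_right ?_ hpos
    calc 2 * (Finset.univ.biUnion tri).card * K ^ (upperPairs s).card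
        ≤ 2 * ((K * n ^ (2 * s)) * K ^ n.choose 2) := by
          rw [mul_assoc]
          exact Nat.mul_le_mul_left 2 hsum
      _ = 2 * (K * n ^ (2 * s)) * K ^ n.choose 2 := (mul_assoc _ _ _).symm
      _ ≤ K ^ (upperPairs s).card * K ^ n.choose 2 := Nat.mul_le_mul_right _ h1
      _ = K ^ n.choose 2 * K ^ (upperPairs s).card := mul_comm _ _
  obtain ⟨f, hf⟩ : ∃ f : E → Fin K, f ∉ low ∪ Finset.univ.biUnion tri := by
    by_contra! hall
    have hcard : (Finset.univ : Finset (E → Fin K)).card ≤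
        (low ∪ Finset.univ.biUnion tri).card := Finset.card_le_card fun f _ => hall f
    rw [Finset.card_univ, Fintype.card_fun, Fintype.card_fin, hE] at hcard
    have := Finset.card_union_le low (Finset.univ.biUnion tri)
    omega
  simp only [Finset.mem_union, not_or, low, tri, Finset.mem_filter, Finset.mem_univ, true_and,
    not_forall, Finset.mem_biUnion, not_exists, Prod.forall, Ps] at hf
  obtain ⟨⟨c, hc⟩, hf⟩ := hf
  refine ⟨colorMatrix f c, colorMatrix_comm f c, colorMatrix_self f c, ?_, ?_⟩
  · refine csSup_le' fun m hm => ?_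
    by_contra hlt
    obtain ⟨a, b, hab⟩ := HasHim.exists_isZeroTriangle hm (not_le.1 hlt)
    exact hf c a b hab
  · intro B hB
    by_contra hle
    exact hc B ⟨hB, not_lt.1 hle⟩

end Coloring

section Asymptotics

lemma eventually_exists_colors (t : ℕ) (ht : 3 ≤ t) :
    ∀ᶠ n : ℕ in atTop, ∃ K : ℕ, 2 ≤ K ∧ n ^ (4 * t) ≤ K ^ (2 * t ^ 2 + 1) ∧
      2 * ((2 * n ^ 2 + 1) ^ (2 * n * ⌊(n : ℝ) ^ (1 - 2 / (t : ℝ))⌋₊)) ^ K < K ^ n.choose 2 := by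
  have htR : (3 : ℝ) ≤ t := by exact_mod_cast ht
  set β : ℝ := 4 * t / (2 * t ^ 2 + 1) with hβ
  have hβ0 : 0 < β := by positivity
  have hγ : 0 < 2 / (t : ℝ) - β := by
    rw [hβ, sub_pos, div_lt_div_iff₀ (by positivity) (by positivity)]
    nlinarith
  have hlog := ((isLittleO_log_rpow_atTop hγ).comp_tendsto
    tendsto_natCast_atTop_atTop).bound (c := 1 / 200) (by norm_num)
  filter_upwards [hlog, eventually_ge_atTop 3] with n hn hn3
  have hnR : (3 : ℝ) ≤ n := by exact_mod_cast hn3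
  have hn0 : (0 : ℝ) < n := by linarith
  have hβ1 : 1 < (n : ℝ) ^ β := Real.one_lt_rpow (by linarith) hβ0
  refine ⟨⌈(n : ℝ) ^ β⌉₊, ?_, ?_, ?_⟩
  · exact Nat.lt_ceil.2 (by simpa using hβ1)
  · have : (n : ℝ) ^ (4 * t) ≤ (⌈(n : ℝ) ^ β⌉₊ : ℝ) ^ (2 * t ^ 2 + 1) := by
      calc (n : ℝ) ^ (4 * t) = ((n : ℝ) ^ β) ^ (2 * t ^ 2 + 1) := by
            rw [← Real.rpow_natCast, ← Real.rpow_natCast, ← Real.rpow_mul hn0.le]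
            congr 1
            rw [hβ]
            push_cast
            field_simp
        _ ≤ _ := pow_le_pow_left₀ (by positivity) (Nat.le_ceil _) _
    exact_mod_cast this
  · set K := ⌈(n : ℝ) ^ β⌉₊ with hK
    set R := ⌊(n : ℝ) ^ (1 - 2 / (t : ℝ))⌋₊ with hR
    have hK2 : 2 ≤ K := Nat.lt_ceil.2 (by simpa using hβ1)
    have hKle : (K : ℝ) ≤ 2 * (n : ℝ) ^ β := by
      have := Nat.ceil_lt_add_one (a := (n : ℝ) ^ β) (by positivity)
      linarith
    have hRle : (R : ℝ) ≤ (n : ℝ) ^ (1 - 2 / (t : ℝ)) := Nat.floor_le (by positivity)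
    refine lt_of_lt_of_le ?_ (Nat.pow_le_pow_left hK2 _)
    rw [← Nat.cast_lt (α := ℝ)]
    push_cast
    rw [← Real.log_lt_log_iff (by positivity) (by positivity), Real.log_mul (by norm_num)
      (by positivity), Real.log_pow, Real.log_pow, Real.log_pow]
    have hlog3 : Real.log (2 * (n : ℝ) ^ 2 + 1) ≤ 3 * Real.log n := by
      rw [show (3 : ℝ) * Real.log n = Real.log ((n : ℝ) ^ 3) by rw [Real.log_pow]; norm_num]
      refine Real.log_le_log (by positivity) ?_
      nlinarith [sq_nonneg ((n : ℝ))]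
    have hlogn : Real.log n ≤ 1 / 200 * (n : ℝ) ^ (2 / (t : ℝ) - β) := by
      simp only [Function.comp_apply, Real.norm_eq_abs] at hn
      rw [abs_of_nonneg (Real.rpow_nonneg hn0.le _)] at hn
      exact (le_abs_self _).trans hn
    have hlog0 : 0 ≤ Real.log (2 * (n : ℝ) ^ 2 + 1) := Real.log_nonneg (by nlinarith)
    have hprod : (n : ℝ) ^ β * (n : ℝ) ^ (1 - 2 / (t : ℝ)) * (n : ℝ) ^ (2 / (t : ℝ) - β) = n := by
      rw [← Real.rpow_add hn0, ← Real.rpow_add hn0]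
      ring_nf
      simp
    have hmain : (K : ℝ) * ((2 * n * R : ℕ) * Real.log (2 * (n : ℝ) ^ 2 + 1)) ≤
        3 / 50 * (n : ℝ) ^ 2 := by
      push_cast
      calc (K : ℝ) * (2 * n * R * Real.log (2 * (n : ℝ) ^ 2 + 1))
          ≤ (2 * (n : ℝ) ^ β) * (2 * n * (n : ℝ) ^ (1 - 2 / (t : ℝ)) *
            (3 * (1 / 200 * (n : ℝ) ^ (2 / (t : ℝ) - β)))) := by
            gcongr
            linarith
        _ = 3 / 50 * n * ((n : ℝ) ^ β * (n : ℝ) ^ (1 - 2 / (t : ℝ)) *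
            (n : ℝ) ^ (2 / (t : ℝ) - β)) := by ring
        _ = 3 / 50 * (n : ℝ) ^ 2 := by rw [hprod]; ring
    have hl2 := Real.log_two_gt_d9
    have hl2' := Real.log_two_lt_d9
    have hchoose : ((n.choose 2 : ℕ) : ℝ) = n * (n - 1) / 2 := Nat.cast_choose_two ℝ n
    rw [hchoose]
    nlinarith

end Asymptotics

theorem stmt13 (F : Type) [Field F] (t : ℕ) (ht : 3 ≤ t) :
    ∃ n₀ : ℕ, ∀ n : ℕ, n₀ ≤ n →
      ∃ A : Fin n → Fin n → Prop,
        (∀ i j, A i j ↔ A j i) ∧ (∀ i, A i i) ∧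
        him A ≤ 2 * t ∧
        ∀ B : Matrix (Fin n) (Fin n) F, SameSupport B A →
          (n : ℝ) ^ (1 - 2 / (t : ℝ)) ≤ (B.rank : ℝ) := by
  classical
  obtain ⟨n₀, hn₀⟩ := eventually_atTop.1 (eventually_exists_colors t ht)
  refine ⟨n₀, fun n hn => ?_⟩
  obtain ⟨K, hK2, hK, hlow⟩ := hn₀ n hn
  have hpairs : (upperPairs (2 * t)).card = 2 * t ^ 2 + t := by
    have := card_upperPairs_mul_two (2 * t)
    nlinarith
  obtain ⟨A, hsymm, hdiag, hhim, hrank⟩ := exists_him_le_of_card_lt F (n := n) (s := 2 * t)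
    (K := K) (by omega) (by
      calc 2 * (K * n ^ (2 * (2 * t))) = 2 * (K * n ^ (4 * t)) := by
            rw [← mul_assoc 2 2 t]; norm_num
        _ ≤ K * (K * K ^ (2 * t ^ 2 + 1)) := by gcongr
        _ = K ^ (2 * t ^ 2 + 3) := by ring
        _ ≤ K ^ (upperPairs (2 * t)).card := Nat.pow_le_pow_right (by omega) (by omega)) hlow
  exact ⟨A, hsymm, hdiag, hhim, fun B hB => (Nat.lt_of_floor_lt (hrank B hB)).le⟩
end

section
/- Let H be a non-bipartite graph on h vertices with adjacency matrix A_H, and suppose there is a family ℬ of bicliques that r-covers the bipartite complement (H*)^c of the associated bipartite graph H*. Then there exists a matrix A'_H ∈ ℝ^{h×h} with the same support as A_H and rank_ℝ(A'_H) ≤ (r+1)^r. In particular, the support-rank of A_H over ℝ is at most (r+1)^r. -/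
open Filter

/-- A family `B` of pairs of vertex sets `r`-covers the bipartite graph with edge
relation `E : X → Y → Prop`: every member is a biclique, together they cover all
edges, and every vertex lies in at most `r` members of the family. -/
def RCovers {ι X Y : Type*} (E : X → Y → Prop) (B : ι → Set X × Set Y) (r : ℕ) : Prop :=
  (∀ i, ∀ x ∈ (B i).1, ∀ y ∈ (B i).2, E x y) ∧
  (∀ x y, E x y → ∃ i, x ∈ (B i).1 ∧ y ∈ (B i).2) ∧
  (∀ x : X, {i | x ∈ (B i).1}.ncard ≤ r) ∧
  (∀ y : Y, {i | y ∈ (B i).2}.ncard ≤ r)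

/-- A finite set of at most `r` naturals is the set of natural values of an `r`-tuple of reals. -/
theorem exists_tuple_eq_natCast_iff {s r : ℕ} (S : Set (Fin s)) (hS : S.ncard ≤ r) :
    ∃ a : Fin r → ℝ, ∀ i : Fin s, (∃ k, a k = (i : ℕ)) ↔ i ∈ S := by
  classical
  obtain ⟨e⟩ : Nonempty (S ↪ Fin r) := Function.Embedding.nonempty_of_card_le <| by
    rwa [Fintype.card_fin, ← Nat.card_eq_fintype_card, Nat.card_coe_set_eq]
  refine ⟨Function.extend e (fun i => ((i : Fin s) : ℕ)) fun _ => -1, fun i => ⟨?_, fun hi => ?_⟩⟩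
  · rintro ⟨k, hk⟩
    by_cases h : ∃ j, e j = k
    · obtain ⟨j, rfl⟩ := h
      rw [e.injective.extend_apply, Nat.cast_inj] at hk
      rw [← Fin.ext hk]
      exact j.2
    · rw [Function.extend_apply' _ _ _ h] at hk
      have : (0 : ℝ) ≤ (i : ℕ) := Nat.cast_nonneg _
      linarith
  · exact ⟨e ⟨i, hi⟩, e.injective.extend_apply _ _ _⟩

/-- A matrix obtained by multiplying the values of a polynomial of degree at most `r`
(depending on the column) at `n` points (depending on the row) has rank at most `(r + 1) ^ n`. -/
theorem rank_prod_eval_le {I J R : Type*} [Fintype J] [CommRing R] [StrongRankCondition R]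
    {n r : ℕ} (a : I → Fin n → R) (q : J → Polynomial R) (hq : ∀ j, (q j).natDegree ≤ r) :
    (Matrix.of fun i j => ∏ k, (q j).eval (a i k)).rank ≤ (r + 1) ^ n := by
  let P : Matrix I (Fin n → Fin (r + 1)) R := Matrix.of fun i f => ∏ k, a i k ^ (f k : ℕ)
  let Q : Matrix (Fin n → Fin (r + 1)) J R := Matrix.of fun f j => ∏ k, (q j).coeff (f k)
  have key : (Matrix.of fun i j => ∏ k, (q j).eval (a i k)) = P * Q := by
    ext i j
    simp only [P, Q, Matrix.mul_apply, Matrix.of_apply, ← Finset.prod_mul_distrib]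
    rw [← Fintype.prod_sum fun k (d : Fin (r + 1)) => a i k ^ (d : ℕ) * (q j).coeff d]
    refine Finset.prod_congr rfl fun k _ => ?_
    rw [Polynomial.eval_eq_sum_range' (Nat.lt_succ_of_le (hq j)), Finset.sum_range]
    exact Finset.sum_congr rfl fun d _ => mul_comm _ _
  rw [key]
  refine (Matrix.rank_mul_le_left _ _).trans ((Matrix.rank_le_card_width _).trans ?_)
  simp

/-- If `E` is covered by bicliques, each vertex lying in at most `r` of them, then the complement
of `E` has the same support as a real matrix of rank at most `(r + 1) ^ r`. -/
theorem RCovers.exists_sameSupport_rank_le {X Y : Type*} [Fintype Y] {E : X → Y → Prop}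
    {s r : ℕ} {B : Fin s → Set X × Set Y} (hB : RCovers E B r) :
    ∃ A : Matrix X Y ℝ, SameSupport A (fun x y => ¬ E x y) ∧ A.rank ≤ (r + 1) ^ r := by
  classical
  obtain ⟨hbiclique, hcover, hX, hY⟩ := hB
  choose a ha using fun x => exists_tuple_eq_natCast_iff _ (hX x)
  let q : Y → Polynomial ℝ := fun y =>
    ∏ i with y ∈ (B i).2, (Polynomial.X - Polynomial.C ((i : ℕ) : ℝ))
  have hq : ∀ y, (q y).natDegree ≤ r := fun y => by
    rw [Polynomial.natDegree_finsetProd_X_sub_C_eq_card, ← Set.ncard_coe_finset]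
    simpa using hY y
  refine ⟨_, fun x y => ?_, rank_prod_eval_le a q hq⟩
  rw [not_not]
  simp only [Matrix.of_apply, q, Polynomial.eval_prod, Finset.prod_eq_zero_iff, Finset.mem_univ,
    true_and, Finset.mem_filter, Polynomial.eval_sub, Polynomial.eval_X, Polynomial.eval_C,
    sub_eq_zero]
  constructor
  · rintro ⟨k, i, hi, hk⟩
    exact hbiclique i x ((ha x i).1 ⟨k, hk⟩) y hi
  · intro h
    obtain ⟨i, hx, hy⟩ := hcover x y h
    obtain ⟨k, hk⟩ := (ha x i).2 hx
    exact ⟨k, i, hy, hk⟩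

theorem stmt14 {V : Type} [Fintype V] (H : SimpleGraph V) (hH : ¬ H.Colorable 2)
    (r s : ℕ) (B : Fin s → Set V × Set V)
    (hB : RCovers (fun u w : V => ¬ H.Adj u w) B r) :
    (∃ A' : Matrix V V ℝ, SameSupport A' H.Adj ∧ A'.rank ≤ (r + 1) ^ r) ∧
    supportRank ℝ H.Adj ≤ (r + 1) ^ r := by
  obtain ⟨A, hA, hrank⟩ := hB.exists_sameSupport_rank_le
  simp only [not_not] at hA
  exact ⟨⟨A, hA, hrank⟩, le_trans (Nat.sInf_le ⟨A, hA, rfl⟩) hrank⟩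
end

section
/- Every connected bipartite incomparable graph is undecomposable, i.e., it admits no bipartite decomposition. -/
/-- A bipartite decomposition `(D, N, R)` of the bipartite graph `H` with
bipartition classes `X, Y`. -/
def BipartiteDecomp {V : Type*} (H : SimpleGraph V) (X Y : Set V)
    (D N R : Set V) : Prop :=
  -- (D, N, R) is a partition of V(H)
  (D ∪ N ∪ R = Set.univ) ∧ Disjoint D N ∧ Disjoint D R ∧ Disjoint N R ∧
  -- 1. N is non-empty and separates D and R
  N.Nonempty ∧
  (∀ (d r : V), d ∈ D → r ∈ R → ∀ p : H.Walk d r, ∃ v ∈ p.support, v ∈ N) ∧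
  -- 2. |D ∩ X| ≥ 2 or |D ∩ Y| ≥ 2
  (2 ≤ (D ∩ X).ncard ∨ 2 ≤ (D ∩ Y).ncard) ∧
  -- 3. N induces a biclique
  (∀ u ∈ N ∩ X, ∀ v ∈ N ∩ Y, H.Adj u v) ∧
  -- 4. (D ∩ X) ∪ (N ∩ Y) and (D ∩ Y) ∪ (N ∩ X) induce bicliques
  (∀ u ∈ D ∩ X, ∀ v ∈ N ∩ Y, H.Adj u v) ∧
  (∀ u ∈ D ∩ Y, ∀ v ∈ N ∩ X, H.Adj u v)

namespace BipartiteDecomp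

variable {V : Type*} {H : SimpleGraph V} {X Y D N R : Set V}

theorem symm (h : BipartiteDecomp H X Y D N R) : BipartiteDecomp H Y X D N R := by
  obtain ⟨hcov, hDN, hDR, hNR, hne, hsep, hcard, hN, hX, hY⟩ := h
  exact ⟨hcov, hDN, hDR, hNR, hne, hsep, hcard.symm,
    fun u hu v hv => (hN v hv u hu).symm, hY, hX⟩

theorem mem_or_mem_of_adj (h : BipartiteDecomp H X Y D N R) {d v : V} (hd : d ∈ D)
    (hadj : H.Adj d v) : v ∈ D ∨ v ∈ N := by
  obtain ⟨hcov, hDN, -, hNR, -, hsep, -⟩ := h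
  have hv : v ∈ D ∪ N ∪ R := hcov ▸ Set.mem_univ v
  rcases hv with hv | hv
  · exact hv
  · obtain ⟨w, hw, hwN⟩ := hsep d v hd hv hadj.toWalk
    have hw' : w = d ∨ w = v := by simpa using hw
    rcases hw' with rfl | rfl
    · exact (Set.disjoint_left.mp hDN hd hwN).elim
    · exact (Set.disjoint_left.mp hNR hwN hv).elim

theorem ncard_inter_left_lt_two (h : BipartiteDecomp H X Y D N R)
    (hpart : ∀ v, (v ∈ X ∧ v ∉ Y) ∨ (v ∈ Y ∧ v ∉ X))
    (hbip : ∀ u v, H.Adj u v → (u ∈ X ∧ v ∈ Y) ∨ (u ∈ Y ∧ v ∈ X))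
    (hinc : ∀ u v : V, u ≠ v → ¬ (H.neighborSet u ⊆ H.neighborSet v)) :
    (D ∩ X).ncard < 2 := by
  by_contra! hcard
  obtain ⟨u, v, ⟨huD, huX⟩, ⟨hvD, hvX⟩, huv⟩ :=
    (Set.one_lt_ncard_iff (Set.finite_of_ncard_pos (by omega))).mp hcard
  have hnbr := fun {d w : V} => h.mem_or_mem_of_adj (d := d) (v := w)
  obtain ⟨-, hDN, -, -, ⟨n, hn⟩, -, -, hNN, hDX, hDY⟩ := h
  have hY_of_adj : ∀ {a b}, a ∈ X → H.Adj a b → b ∈ Y := by grind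
  have hX_of_adj : ∀ {a b}, a ∈ Y → H.Adj a b → b ∈ X := by grind
  have hne : ∀ {a b}, a ∈ D → b ∈ N → a ≠ b := fun ha hb => hDN.ne_of_mem ha hb
  have hNX : ∀ w ∈ N, w ∉ X := by
    intro w hwN hwX
    refine hinc u w (hne huD hwN) fun y hy => ?_
    have hyY := hY_of_adj huX hy
    rcases hnbr huD hy with hyD | hyN
    · exact (hDY y ⟨hyD, hyY⟩ w ⟨hwN, hwX⟩).symm
    · exact hNN w ⟨hwN, hwX⟩ y ⟨hyN, hyY⟩
  have hnY : n ∈ Y := by grind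
  obtain ⟨y, huy, hvy⟩ := Set.not_subset.mp (hinc u v huv)
  have hyY := hY_of_adj huX huy
  have hyD : y ∈ D := (hnbr huD huy).resolve_right
    fun hyN => hvy (hDX v ⟨hvD, hvX⟩ y ⟨hyN, hyY⟩)
  refine hinc y n (hne hyD hn) fun x hx => ?_
  have hxX := hX_of_adj hyY hx
  have hxD : x ∈ D := (hnbr hyD hx).resolve_right fun hxN => hNX x hxN hxX
  exact (hDX x ⟨hxD, hxX⟩ n ⟨hn, hnY⟩).symm

end BipartiteDecomp

theorem stmt19 {V : Type} [Fintype V] (H : SimpleGraph V) (X Y : Set V)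
    (hpart : ∀ v, (v ∈ X ∧ v ∉ Y) ∨ (v ∈ Y ∧ v ∉ X))
    (hbip : ∀ u v, H.Adj u v → (u ∈ X ∧ v ∈ Y) ∨ (u ∈ Y ∧ v ∈ X))
    (hconn : H.Connected)
    (hinc : ∀ u v : V, u ≠ v → ¬ (H.neighborSet u ⊆ H.neighborSet v)) :
    ¬ ∃ D N R : Set V, BipartiteDecomp H X Y D N R := by
  rintro ⟨D, N, R, h⟩
  have hX := h.ncard_inter_left_lt_two hpart hbip hinc
  have hY := h.symm.ncard_inter_left_lt_two (fun v => (hpart v).symm)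
    (fun u v huv => (hbip u v huv).symm) hinc
  obtain ⟨-, -, -, -, -, -, hcard, -⟩ := h
  omega
end
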